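/- arXiv:1506.08270 — 2 statements merged into one kernel-verified Lean document; each statement's English description precedes it below -/
import Mathlib

section
/- Suppose λ* ∈ ℝ and w is an admissible function with w(x) > 0 for all x ∈ Ω_h and L_h w(x) + λ* w(x) = 0 for all x ∈ Ω_h. Then for every λ ∈ ℝ with λ ≠ λ* and every admissible function v, not identically zero, satisfying L_h v(x) + λ v(x) = 0 for all x ∈ Ω_h, the function v changes sign: there exist x₁, x₂ ∈ Ω_h with v(x₁) > 0 and v(x₂) < 0. -/
/-- Euclidean norm of an integer vector. -/
noncomputable def ynorm {n : ℕ} (y : Fin n → ℤ) : ℝ :=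
  Real.sqrt (∑ i, ((y i : ℝ)) ^ 2)

/-- The linear finite difference scheme L_h on the lattice hℤⁿ, with lattice points
identified with their integer coordinates: the lattice point h·x corresponds to x ∈ ℤⁿ,
and h·x ± h·y_k corresponds to x ± y_k. -/
noncomputable def Lh {n K : ℕ} (h : ℝ) (Y : Fin K → (Fin n → ℤ))
    (abar bbar : Fin K → (Fin n → ℤ) → ℝ) (cbar : (Fin n → ℤ) → ℝ)
    (u : (Fin n → ℤ) → ℝ) (x : Fin n → ℤ) : ℝ :=
  (∑ k, (abar k x * (u (x + Y k) + u (x - Y k) - 2 * u x) / (h ^ 2 * (ynorm (Y k)) ^ 2)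
      + bbar k x * (u (x + Y k) - u (x - Y k)) / (2 * h * ynorm (Y k))))
    + cbar x * u x

/-- Discrete connectedness of Ω_h: any two points are joined by a chain of points of Ω_h
whose consecutive terms differ by ± a canonical basis vector (i.e. by ±h·e_i in hℤⁿ). -/
def DiscretelyConnected {n : ℕ} (Ωh : Finset (Fin n → ℤ)) : Prop :=
  ∀ p ∈ Ωh, ∀ q ∈ Ωh,
    Relation.ReflTransGen
      (fun a b => b ∈ Ωh ∧ ∃ i : Fin n, b = a + Pi.single i 1 ∨ b = a - Pi.single i 1) p q

/-- `L_h` as a combination of the neighbouring values with coefficients `a/(h²|y|²) ± b/(2h|y|)`,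
at a zero of `u`. -/
lemma Lh_eq_of_apply_eq_zero {n K : ℕ} (h : ℝ) (Y : Fin K → (Fin n → ℤ))
    (abar bbar : Fin K → (Fin n → ℤ) → ℝ) (cbar : (Fin n → ℤ) → ℝ)
    {u : (Fin n → ℤ) → ℝ} {x : Fin n → ℤ} (hx : u x = 0) :
    Lh h Y abar bbar cbar u x =
      ∑ k, ((abar k x / (h ^ 2 * (ynorm (Y k)) ^ 2) + bbar k x / (2 * h * ynorm (Y k)))
          * u (x + Y k)
        + (abar k x / (h ^ 2 * (ynorm (Y k)) ^ 2) - bbar k x / (2 * h * ynorm (Y k)))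
          * u (x - Y k)) := by
  simp only [Lh, hx, mul_zero, add_zero, sub_zero]
  exact Finset.sum_congr rfl fun k _ => by ring

lemma Lh_sub_smul {n K : ℕ} (h : ℝ) (Y : Fin K → (Fin n → ℤ))
    (abar bbar : Fin K → (Fin n → ℤ) → ℝ) (cbar : (Fin n → ℤ) → ℝ)
    (u w : (Fin n → ℤ) → ℝ) (t : ℝ) (x : Fin n → ℤ) :
    Lh h Y abar bbar cbar (fun y => u y - t * w y) x =
      Lh h Y abar bbar cbar u x - t * Lh h Y abar bbar cbar w x := by
  simp only [Lh, mul_sub, mul_add, Finset.mul_sum, add_sub_add_comm, ← Finset.sum_sub_distrib]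
  refine congrArg₂ (· + ·) (Finset.sum_congr rfl fun k _ => ?_) ?_ <;> ring

lemma Lh_neg {n K : ℕ} (h : ℝ) (Y : Fin K → (Fin n → ℤ))
    (abar bbar : Fin K → (Fin n → ℤ) → ℝ) (cbar : (Fin n → ℤ) → ℝ)
    (u : (Fin n → ℤ) → ℝ) (x : Fin n → ℤ) :
    Lh h Y abar bbar cbar (-u) x = -Lh h Y abar bbar cbar u x := by
  simp only [Lh, Pi.neg_apply, neg_add, ← Finset.sum_neg_distrib]
  refine congrArg₂ (· + ·) (Finset.sum_congr rfl fun k _ => ?_) ?_ <;> ring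

lemma ynorm_nonneg {n : ℕ} (y : Fin n → ℤ) : 0 ≤ ynorm y :=
  Real.sqrt_nonneg _

lemma add_pos_and_sub_pos_of_abs_div {a b c d : ℝ} (hd : 0 ≤ d) (hab : 0 < a / c - |b| / d) :
    0 < a / c + b / d ∧ 0 < a / c - b / d := by
  have h₁ : b / d ≤ |b| / d := by gcongr; exact le_abs_self b
  have h₂ : -b / d ≤ |b| / d := by gcongr; exact neg_le_abs b
  rw [neg_div] at h₂
  constructor <;> linarith

section MaximumPrinciple

variable {n K : ℕ} {h : ℝ} {Y : Fin K → (Fin n → ℤ)}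
  {abar bbar : Fin K → (Fin n → ℤ) → ℝ} {cbar : (Fin n → ℤ) → ℝ}

/-- A nonnegative function has `L_h u ≥ 0` at its zeros. -/
lemma Lh_nonneg_of_nonneg_of_apply_eq_zero {x : Fin n → ℤ} (hh : 0 < h)
    (hell : ∀ k, 0 < abar k x / (h ^ 2 * (ynorm (Y k)) ^ 2) - |bbar k x| / (2 * h * ynorm (Y k)))
    {u : (Fin n → ℤ) → ℝ} (hu : ∀ y, 0 ≤ u y) (hx : u x = 0) :
    0 ≤ Lh h Y abar bbar cbar u x := by
  rw [Lh_eq_of_apply_eq_zero h Y abar bbar cbar hx]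
  refine Finset.sum_nonneg fun k _ => ?_
  obtain ⟨hp, hm⟩ := add_pos_and_sub_pos_of_abs_div
    (mul_nonneg (by positivity) (ynorm_nonneg _)) (hell k)
  exact add_nonneg (mul_nonneg hp.le (hu _)) (mul_nonneg hm.le (hu _))

/-- If a nonnegative function satisfies `L_h u = 0` at one of its zeros, it vanishes at all the
neighbours of that point. -/
lemma apply_neighbors_eq_zero_of_Lh_eq_zero {x : Fin n → ℤ} (hh : 0 < h)
    (hell : ∀ k, 0 < abar k x / (h ^ 2 * (ynorm (Y k)) ^ 2) - |bbar k x| / (2 * h * ynorm (Y k)))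
    {u : (Fin n → ℤ) → ℝ} (hu : ∀ y, 0 ≤ u y) (hx : u x = 0)
    (hL : Lh h Y abar bbar cbar u x = 0) (k : Fin K) :
    u (x + Y k) = 0 ∧ u (x - Y k) = 0 := by
  have hcoef := fun k => add_pos_and_sub_pos_of_abs_div
    (mul_nonneg (by positivity : 0 ≤ 2 * h) (ynorm_nonneg _)) (hell k)
  rw [Lh_eq_of_apply_eq_zero h Y abar bbar cbar hx, Finset.sum_eq_zero_iff_of_nonneg
    fun k _ => add_nonneg (mul_nonneg (hcoef k).1.le (hu _)) (mul_nonneg (hcoef k).2.le (hu _))]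
    at hL
  obtain ⟨hp, hm⟩ := (add_eq_zero_iff_of_nonneg (mul_nonneg (hcoef k).1.le (hu _))
    (mul_nonneg (hcoef k).2.le (hu _))).1 (hL k (Finset.mem_univ k))
  exact ⟨(mul_eq_zero.1 hp).resolve_left (hcoef k).1.ne',
    (mul_eq_zero.1 hm).resolve_left (hcoef k).2.ne'⟩

variable {Ωh : Finset (Fin n → ℤ)}

/-- Strong maximum principle: a nonnegative nonzero eigenfunction is positive on `Ωh`. -/
lemma pos_of_nonneg_eigenfunction (hh : 0 < h)
    (hYbasis : ∀ i : Fin n, ∃ k, Y k = Pi.single i 1) (hconn : DiscretelyConnected Ωh)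
    (hell : ∀ x ∈ Ωh, ∀ k,
      0 < abar k x / (h ^ 2 * (ynorm (Y k)) ^ 2) - |bbar k x| / (2 * h * ynorm (Y k)))
    {lam : ℝ} {v : (Fin n → ℤ) → ℝ} (hvadm : ∀ x ∉ Ωh, v x = 0) (hv0 : v ≠ 0)
    (hv : ∀ x, 0 ≤ v x)
    (hveig : ∀ x ∈ Ωh, Lh h Y abar bbar cbar v x + lam * v x = 0) :
    ∀ x ∈ Ωh, 0 < v x := by
  intro p hp
  refine (hv p).lt_of_ne' fun hvp => hv0 (funext fun q => ?_)
  by_cases hq : q ∈ Ωh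
  · have hchain := hconn p hp q hq
    clear hq
    suffices q ∈ Ωh ∧ v q = 0 from this.2
    induction hchain with
    | refl => exact ⟨hp, hvp⟩
    | tail _ hstep ih =>
      obtain ⟨hb, i, hi⟩ := hstep
      obtain ⟨ha, hva⟩ := ih
      obtain ⟨k, hk⟩ := hYbasis i
      have hL := hveig _ ha
      rw [hva, mul_zero, add_zero] at hL
      have hz := apply_neighbors_eq_zero_of_Lh_eq_zero hh (hell _ ha) hv hva hL k
      rw [hk] at hz
      rcases hi with rfl | rfl
      exacts [⟨hb, hz.1⟩, ⟨hb, hz.2⟩]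
  · exact hvadm q hq

/-- Eigenvalues of positive eigenfunctions are comparable, in either order. -/
lemma eigenvalue_le_of_pos (hh : 0 < h) (hΩne : Ωh.Nonempty)
    (hell : ∀ x ∈ Ωh, ∀ k,
      0 < abar k x / (h ^ 2 * (ynorm (Y k)) ^ 2) - |bbar k x| / (2 * h * ynorm (Y k)))
    {lam mu : ℝ} {v w : (Fin n → ℤ) → ℝ}
    (hvadm : ∀ x ∉ Ωh, v x = 0) (hwadm : ∀ x ∉ Ωh, w x = 0)
    (hvpos : ∀ x ∈ Ωh, 0 < v x) (hwpos : ∀ x ∈ Ωh, 0 < w x)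
    (hveig : ∀ x ∈ Ωh, Lh h Y abar bbar cbar v x + lam * v x = 0)
    (hweig : ∀ x ∈ Ωh, Lh h Y abar bbar cbar w x + mu * w x = 0) :
    lam ≤ mu := by
  obtain ⟨x, hx, hmin⟩ := Ωh.exists_min_image (fun y => v y / w y) hΩne
  have hzero : v x - v x / w x * w x = 0 := by
    rw [div_mul_cancel₀ _ (hwpos x hx).ne', sub_self]
  have hnonneg : ∀ y, 0 ≤ v y - v x / w x * w y := by
    intro y
    by_cases hy : y ∈ Ωh
    · exact sub_nonneg.2 ((le_div_iff₀ (hwpos y hy)).1 (hmin y hy))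
    · simp [hvadm y hy, hwadm y hy]
  have hL := Lh_nonneg_of_nonneg_of_apply_eq_zero (cbar := cbar) hh (hell x hx) hnonneg hzero
  rw [Lh_sub_smul, eq_neg_of_add_eq_zero_left (hveig x hx),
    eq_neg_of_add_eq_zero_left (hweig x hx)] at hL
  refine le_of_mul_le_mul_right ?_ (hvpos x hx)
  linear_combination hL - mu * hzero

/-- The eigenvalue of a nonnegative nonzero eigenfunction is the principal one. -/
lemma eigenvalue_eq_of_nonneg (hh : 0 < h)
    (hYbasis : ∀ i : Fin n, ∃ k, Y k = Pi.single i 1)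
    (hΩne : Ωh.Nonempty) (hconn : DiscretelyConnected Ωh)
    (hell : ∀ x ∈ Ωh, ∀ k,
      0 < abar k x / (h ^ 2 * (ynorm (Y k)) ^ 2) - |bbar k x| / (2 * h * ynorm (Y k)))
    {lam mu : ℝ} {v w : (Fin n → ℤ) → ℝ}
    (hvadm : ∀ x ∉ Ωh, v x = 0) (hwadm : ∀ x ∉ Ωh, w x = 0)
    (hv0 : v ≠ 0) (hv : ∀ x ∈ Ωh, 0 ≤ v x) (hwpos : ∀ x ∈ Ωh, 0 < w x)
    (hveig : ∀ x ∈ Ωh, Lh h Y abar bbar cbar v x + lam * v x = 0)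
    (hweig : ∀ x ∈ Ωh, Lh h Y abar bbar cbar w x + mu * w x = 0) :
    lam = mu := by
  have hv' : ∀ x, 0 ≤ v x := fun x =>
    if hx : x ∈ Ωh then hv x hx else (hvadm x hx).ge
  have hvpos := pos_of_nonneg_eigenfunction hh hYbasis hconn hell hvadm hv0 hv' hveig
  exact le_antisymm
    (eigenvalue_le_of_pos hh hΩne hell hvadm hwadm hvpos hwpos hveig hweig)
    (eigenvalue_le_of_pos hh hΩne hell hwadm hvadm hwpos hvpos hweig hveig)

end MaximumPrinciple

/-- eigenfunctions for eigenvalues other than the principal one change sign. -/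
theorem discrete_nonprincipal_eigenfunctions_change_sign
    (n K : ℕ) (hn : 1 ≤ n) (hK : 1 ≤ K) (h : ℝ) (hh : 0 < h)
    (Y : Fin K → (Fin n → ℤ)) (hY0 : ∀ k, Y k ≠ 0)
    (hYbasis : ∀ i : Fin n, ∃ k, Y k = Pi.single i 1)
    (Ωh : Finset (Fin n → ℤ)) (hΩne : Ωh.Nonempty)
    (hconn : DiscretelyConnected Ωh)
    (abar bbar : Fin K → (Fin n → ℤ) → ℝ) (cbar : (Fin n → ℤ) → ℝ)
    (hell : ∀ x ∈ Ωh, ∀ k,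
      0 < abar k x / (h ^ 2 * (ynorm (Y k)) ^ 2) - |bbar k x| / (2 * h * ynorm (Y k)))
    (hc : ∀ x ∈ Ωh, cbar x ≤ 0)
    (lamStar : ℝ) (w : (Fin n → ℤ) → ℝ)
    (hwadm : ∀ x ∉ Ωh, w x = 0) (hwpos : ∀ x ∈ Ωh, 0 < w x)
    (hweig : ∀ x ∈ Ωh, Lh h Y abar bbar cbar w x + lamStar * w x = 0) :
    ∀ lam : ℝ, lam ≠ lamStar →
      ∀ v : (Fin n → ℤ) → ℝ, (∀ x ∉ Ωh, v x = 0) → v ≠ 0 →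
        (∀ x ∈ Ωh, Lh h Y abar bbar cbar v x + lam * v x = 0) →
        (∃ x₁ ∈ Ωh, 0 < v x₁) ∧ (∃ x₂ ∈ Ωh, v x₂ < 0) := by
  intro lam hlam v hvadm hv0 hveig
  constructor
  · by_contra! hneg
    refine hlam (eigenvalue_eq_of_nonneg (v := -v) hh hYbasis hΩne hconn hell ?_ hwadm
      (neg_ne_zero.2 hv0) (fun x hx => neg_nonneg.2 (hneg x hx)) hwpos ?_ hweig)
    · intro x hx
      simp [hvadm x hx]
    · intro x hx
      rw [Lh_neg, Pi.neg_apply]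
      linear_combination -hveig x hx
  · by_contra! hpos
    exact hlam (eigenvalue_eq_of_nonneg hh hYbasis hΩne hconn hell hvadm hwadm hv0 hpos hwpos
      hveig hweig)
end

section
/- For all γ₀, Γ₀, β > 0 there exists C > 0, depending only on γ₀, Γ₀ and β, with the following property. Let h > 0 and let N ≥ 1 be an integer with R := 2Nh ≤ 1, and let I ⊂ ℤ be a finite set with {i : |i| ≤ N−1} ⊆ I. Suppose the coefficients satisfy a_i/h² − |b_i|/(2h) ≥ 0 and c_i ≤ 0 for all i ∈ I, and in addition γ₀ ≤ a_i ≤ Γ₀, |b_i| ≤ β, |c_i| ≤ β for all |i| ≤ N−1. If λ ∈ ℝ and there exists φ : ℤ → ℝ with φ ≥ 0 everywhere, φ_i > 0 for all i ∈ I, and L_h φ(i) + λφ_i ≤ 0 for all i ∈ I, then λ ≤ C/R². -/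
/-- The one-dimensional linear finite difference scheme. -/
noncomputable def Lh1 (h : ℝ) (a b c : ℤ → ℝ) (U : ℤ → ℝ) (i : ℤ) : ℝ :=
  a i * (U (i + 1) + U (i - 1) - 2 * U i) / h ^ 2
    + b i * (U (i + 1) - U (i - 1)) / (2 * h) + c i * U i

/-- Value of the scheme on the barrier `i ↦ (n² - i²)²`. -/
lemma Lh1_barrier {h : ℝ} (hh : h ≠ 0) (a b c : ℤ → ℝ) (n : ℝ) (i : ℤ) :
    h ^ 2 * Lh1 h a b c (fun j => (n ^ 2 - (j : ℝ) ^ 2) ^ 2) i =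
      a i * (8 * (i : ℝ) ^ 2 - 4 * (n ^ 2 - (i : ℝ) ^ 2) + 2)
        + 4 * (b i * h) * i * (1 - (n ^ 2 - (i : ℝ) ^ 2))
        + c i * h ^ 2 * (n ^ 2 - (i : ℝ) ^ 2) ^ 2 := by
  unfold Lh1
  push_cast
  field_simp
  ring

/-- The barrier is a subsolution for an eigenvalue of order `1 / n²`. -/
lemma barrier_subsolution_bound {γ₀ Γ₀ β a d c h m n s : ℝ} (hγ : 0 < γ₀)
    (hh : 0 < h) (hn : 0 < n) (hnh : 2 * n * h ≤ 1) (hm : m = 0 ∨ 1 ≤ |m|) (hmn : |m| ≤ n)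
    (hs : s = n ^ 2 - m ^ 2) (hγa : γ₀ ≤ a) (haΓ : a ≤ Γ₀)
    (hdβ : |d| ≤ β * h) (hda : |d| ≤ 2 * a) (hc : |c| ≤ β) :
    -((4 * Γ₀ + 2 * β + 2 * γ₀) ^ 2 / (8 * γ₀) + β / 4) * s ^ 2 ≤
      n ^ 2 * (a * (8 * m ^ 2 - 4 * s + 2) + 4 * d * m * (1 - s) + c * h ^ 2 * s ^ 2) := by
  have hs0 : 0 ≤ s := by rw [hs, ← sq_abs m]; nlinarith [abs_nonneg m]
  have hβ : 0 ≤ β := (abs_nonneg c).trans hc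
  have hmm : m ^ 2 = |m| ^ 2 := (sq_abs m).symm
  have hm0 := abs_nonneg m
  have hdm : -(2 * a * |m|) ≤ d * m := by
    have h1 : |d * m| ≤ 2 * a * |m| := by
      rw [abs_mul]; exact mul_le_mul_of_nonneg_right hda hm0
    exact (abs_le.mp h1).1
  have hdm' : d * m ≤ β / 2 := by
    have h1 : |d * m| ≤ β * h * n := by
      rw [abs_mul]; exact mul_le_mul hdβ hmn hm0 (by positivity)
    have h2 : β * h * n ≤ β / 2 := by nlinarith
    exact (le_abs_self _).trans (h1.trans h2)
  have hdms : d * m * s ≤ β / 2 * s := mul_le_mul_of_nonneg_right hdm' hs0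
  have hcore : 2 * |m| ^ 2 ≤ 8 * |m| ^ 2 - 8 * |m| + 2 := by
    rcases hm with h0 | h1
    · simp [h0]
    · nlinarith
  have hcoer : 2 * γ₀ * m ^ 2 ≤ a * (8 * m ^ 2 + 2) - 8 * a * |m| := by
    rw [hmm]
    have h1 := mul_le_mul_of_nonneg_left hcore (hγ.le.trans hγa)
    have h2 := mul_le_mul_of_nonneg_right hγa (sq_nonneg |m|)
    linarith
  have has : a * s ≤ Γ₀ * s := mul_le_mul_of_nonneg_right haΓ hs0
  have hmain : 2 * γ₀ * n ^ 2 - (4 * Γ₀ + 2 * β + 2 * γ₀) * s ≤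
      a * (8 * m ^ 2 - 4 * s + 2) + 4 * d * m * (1 - s) := by
    have : γ₀ * m ^ 2 = γ₀ * n ^ 2 - γ₀ * s := by rw [hs]; ring
    linarith
  have hzero : -(β / 4) * s ^ 2 ≤ n ^ 2 * (c * h ^ 2 * s ^ 2) := by
    have h1 : (n * h) ^ 2 ≤ 1 / 4 := by nlinarith [mul_pos hn hh]
    have h2 : |c * (n * h) ^ 2| ≤ β * (1 / 4) := by
      rw [abs_mul, abs_of_nonneg (sq_nonneg (n * h))]
      exact mul_le_mul hc h1 (sq_nonneg _) hβ
    have h3 := mul_le_mul_of_nonneg_right (abs_le.mp h2).1 (sq_nonneg s)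
    linarith
  have hquad : -((4 * Γ₀ + 2 * β + 2 * γ₀) ^ 2 / (8 * γ₀)) * s ^ 2 ≤
      n ^ 2 * (2 * γ₀ * n ^ 2 - (4 * Γ₀ + 2 * β + 2 * γ₀) * s) := by
    generalize 4 * Γ₀ + 2 * β + 2 * γ₀ = P
    have h1 : n ^ 2 * (2 * γ₀ * n ^ 2 - P * s) + P ^ 2 / (8 * γ₀) * s ^ 2
        = (4 * γ₀ * n ^ 2 - P * s) ^ 2 / (8 * γ₀) := by
      field_simp
      ring
    have h2 : 0 ≤ (4 * γ₀ * n ^ 2 - P * s) ^ 2 / (8 * γ₀) := by positivity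
    linarith
  have h1 := mul_le_mul_of_nonneg_left hmain (sq_nonneg n)
  linarith

/-- A monotone scheme preserves the order of two functions touching at `i`. -/
lemma Lh1_le_of_touching {h : ℝ} (hh : 0 < h) {a b c U V : ℤ → ℝ} {i : ℤ}
    (hmono : |b i| * h ≤ 2 * a i) (heq : U i = V i)
    (hr : U (i + 1) ≤ V (i + 1)) (hl : U (i - 1) ≤ V (i - 1)) :
    Lh1 h a b c U i ≤ Lh1 h a b c V i := by
  have hdiff : Lh1 h a b c V i - Lh1 h a b c U i =
      ((2 * a i + b i * h) * (V (i + 1) - U (i + 1))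
        + (2 * a i - b i * h) * (V (i - 1) - U (i - 1))) / (2 * h ^ 2) := by
    unfold Lh1
    rw [heq]
    field_simp
    ring
  have h1 : -(|b i| * h) ≤ b i * h := by nlinarith [neg_abs_le (b i)]
  have h2 : b i * h ≤ |b i| * h := by nlinarith [le_abs_self (b i)]
  have h3 : 0 ≤ Lh1 h a b c V i - Lh1 h a b c U i := by
    rw [hdiff]
    exact div_nonneg (add_nonneg (mul_nonneg (by linarith) (by linarith))
      (mul_nonneg (by linarith) (by linarith))) (by positivity)
  linarith

lemma Lh1_const_mul (h t : ℝ) (a b c U : ℤ → ℝ) (i : ℤ) :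
    Lh1 h a b c (fun j => t * U j) i = t * Lh1 h a b c U i := by
  unfold Lh1
  ring

/-- upper bound λ ≤ C/R² for any λ admitting a positive supersolution
of the one-dimensional scheme, with C depending only on γ₀, Γ₀, β. -/
theorem discrete_eigenvalue_upper_bound_one_dim
    (γ₀ Γ₀ β : ℝ) (hγ : 0 < γ₀) (hΓ : 0 < Γ₀) (hβ : 0 < β) :
    ∃ C : ℝ, 0 < C ∧
      ∀ (h : ℝ) (N : ℕ) (I : Finset ℤ) (a b c : ℤ → ℝ) (lam : ℝ) (φ : ℤ → ℝ),
        0 < h → 1 ≤ N → 2 * (N : ℝ) * h ≤ 1 →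
        (∀ i : ℤ, |i| ≤ (N : ℤ) - 1 → i ∈ I) →
        (∀ i ∈ I, a i / h ^ 2 - |b i| / (2 * h) ≥ 0 ∧ c i ≤ 0) →
        (∀ i : ℤ, |i| ≤ (N : ℤ) - 1 →
          γ₀ ≤ a i ∧ a i ≤ Γ₀ ∧ |b i| ≤ β ∧ |c i| ≤ β) →
        (∀ i : ℤ, 0 ≤ φ i) → (∀ i ∈ I, 0 < φ i) →
        (∀ i ∈ I, Lh1 h a b c φ i + lam * φ i ≤ 0) →
        lam ≤ C / (2 * (N : ℝ) * h) ^ 2 := by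
  refine ⟨4 * ((4 * Γ₀ + 2 * β + 2 * γ₀) ^ 2 / (8 * γ₀) + β / 4), by positivity, ?_⟩
  intro h N I a b c lam φ hh hN hNh hI hmono hcoef hφ hφpos hsuper
  have hNpos : (0 : ℝ) < N := by exact_mod_cast hN
  set w : ℤ → ℝ := fun j => ((N : ℝ) ^ 2 - (j : ℝ) ^ 2) ^ 2 with hw
  have hwpos : ∀ j : ℤ, |j| ≤ (N : ℤ) - 1 → 0 < w j := by
    intro j hj
    have h1 : |(j : ℝ)| < N := by
      have : |j| < (N : ℤ) := by omega
      exact_mod_cast this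
    have h2 : (j : ℝ) ^ 2 < (N : ℝ) ^ 2 := sq_lt_sq' (abs_lt.mp h1).1 (abs_lt.mp h1).2
    exact pow_pos (sub_pos.mpr h2) 2
  obtain ⟨i, hi, hmin⟩ := Finset.exists_min_image (Finset.Icc (-((N : ℤ) - 1)) ((N : ℤ) - 1))
    (fun j => φ j / w j) ⟨0, by rw [Finset.mem_Icc]; omega⟩
  have hiN : |i| ≤ (N : ℤ) - 1 := abs_le.mpr (Finset.mem_Icc.mp hi)
  have hwi := hwpos i hiN
  have hφi := hφpos i (hI i hiN)
  set t := φ i / w i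
  have htpos : 0 < t := div_pos hφi hwi
  have htouch : t * w i = φ i := div_mul_cancel₀ _ hwi.ne'
  have hbelow : ∀ j : ℤ, |j| ≤ N → t * w j ≤ φ j := by
    intro j hj
    rcases (lt_or_eq_of_le hj) with hlt | heq
    · have hj' : |j| ≤ (N : ℤ) - 1 := by omega
      exact (le_div_iff₀ (hwpos j hj')).mp (hmin j (Finset.mem_Icc.mpr (abs_le.mp hj')))
    · have h1 : |(j : ℝ)| = N := by exact_mod_cast heq
      have h2 : w j = 0 := by
        simp only [hw]
        rw [← sq_abs (j : ℝ), h1, sub_self]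
        norm_num
      rw [h2, mul_zero]
      exact hφ j
  obtain ⟨hγa, haΓ, hbβ, hcβ⟩ := hcoef i hiN
  have hbh : |b i| * h ≤ 2 * a i := by
    have h1 := sub_nonneg.mp (hmono i (hI i hiN)).1
    rw [div_le_div_iff₀ (by positivity) (by positivity)] at h1
    nlinarith
  have hcomp : t * Lh1 h a b c w i ≤ Lh1 h a b c φ i := by
    rw [← Lh1_const_mul]
    exact Lh1_le_of_touching hh hbh htouch
      (hbelow _ (by rw [abs_le] at hiN ⊢; omega)) (hbelow _ (by rw [abs_le] at hiN ⊢; omega))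
  have habs : |b i * h| = |b i| * h := by rw [abs_mul, abs_of_pos hh]
  have hbar := barrier_subsolution_bound (m := (i : ℝ)) (d := b i * h) hγ hh hNpos hNh
    (by
      rcases eq_or_ne i 0 with h0 | h0
      · exact Or.inl (by simp [h0])
      · exact Or.inr (by exact_mod_cast Int.one_le_abs h0))
    (by
      have : |i| ≤ (N : ℤ) := by omega
      exact_mod_cast this)
    rfl hγa haΓ (by rw [habs]; exact mul_le_mul_of_nonneg_right hbβ hh.le)
    (by rw [habs]; exact hbh) hcβ
  rw [← Lh1_barrier hh.ne'] at hbar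
  change -_ * w i ≤ (N : ℝ) ^ 2 * (h ^ 2 * Lh1 h a b c w i) at hbar
  generalize (4 * Γ₀ + 2 * β + 2 * γ₀) ^ 2 / (8 * γ₀) + β / 4 = K at hbar ⊢
  have hlam : lam * φ i ≤ -(t * Lh1 h a b c w i) := by
    linarith [hsuper i (hI i hiN)]
  rw [← htouch] at hlam
  have hlam' : lam * w i ≤ -Lh1 h a b c w i :=
    le_of_mul_le_mul_left (by linarith) htpos
  rw [le_div_iff₀ (by positivity)]
  refine le_of_mul_le_mul_right ?_ hwi
  have h1 := mul_le_mul_of_nonneg_left hlam' (by positivity : 0 ≤ (N : ℝ) ^ 2 * h ^ 2)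
  linarith
end
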